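/- arXiv:1309.5328 — 2 statements merged into one kernel-verified Lean document; each statement's English description precedes it below -/
import Mathlib

section
/- The set Z := {β ∈ [0,∞) : ψ(β) = 0} is nonempty and has a maximum Φ₀ := max Z, and the restriction of ψ to [Φ₀, ∞) is continuous, strictly increasing, and maps [Φ₀, ∞) bijectively onto [0, ∞) (so that it admits an inverse bijection Φ : [0,∞) → [Φ₀,∞)). -/
open MeasureTheory

/-- A continuous strictly convex function on `[0,∞)` vanishing at `0` and tending to `∞` has a
largest zero, after which it is an increasing bijection onto `[0,∞)`. -/
theorem StrictConvexOn.exists_isGreatest_zero_bijOn {f : ℝ → ℝ}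
    (hf : StrictConvexOn ℝ (Set.Ici 0) f) (hc : ContinuousOn f (Set.Ici 0)) (h0 : f 0 = 0)
    (ht : Filter.Tendsto f Filter.atTop Filter.atTop) :
    ∃ a : ℝ, IsGreatest {b : ℝ | 0 ≤ b ∧ f b = 0} a ∧ ContinuousOn f (Set.Ici a) ∧
      StrictMonoOn f (Set.Ici a) ∧ Set.BijOn f (Set.Ici a) (Set.Ici 0) := by
  have hclosed : IsClosed {b : ℝ | 0 ≤ b ∧ f b = 0} :=
    hc.preimage_isClosed_of_isClosed isClosed_Ici (isClosed_singleton (x := (0 : ℝ)))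
  have hne : {b : ℝ | 0 ≤ b ∧ f b = 0}.Nonempty := ⟨0, le_rfl, h0⟩
  have hbdd : BddAbove {b : ℝ | 0 ≤ b ∧ f b = 0} := by
    obtain ⟨M, hM⟩ := Filter.eventually_atTop.1 (ht.eventually_gt_atTop 0)
    refine ⟨M, fun b hb => ?_⟩
    by_contra! hlt
    exact (hM b hlt.le).ne' hb.2
  obtain ⟨a, ha⟩ : ∃ a, IsGreatest {b : ℝ | 0 ≤ b ∧ f b = 0} a :=
    ⟨_, hclosed.csSup_mem hne hbdd, fun b hb => le_csSup hbdd hb⟩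
  have ha0 : 0 ≤ a := ha.1.1
  have hca : ContinuousOn f (Set.Ici a) := hc.mono (Set.Ici_subset_Ici.2 ha0)
  have hlarge (b y : ℝ) : ∃ c, b ≤ c ∧ y ≤ f c :=
    ((Filter.eventually_ge_atTop b).and (ht.eventually_ge_atTop y)).exists
  have hpos {b : ℝ} (hb : a < b) : 0 < f b := by
    by_contra! hle
    obtain ⟨c, hbc, hc0⟩ := hlarge b 0
    obtain ⟨d, hd, hd0⟩ := intermediate_value_Icc hbc
      (hca.mono fun x hx => hb.le.trans hx.1) ⟨hle, hc0⟩
    linarith [ha.2 ⟨ha0.trans (hb.le.trans hd.1), hd0⟩, hd.1]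
  have hmono : StrictMonoOn f (Set.Ici a) := by
    intro b hb c _ hbc
    rcases eq_or_lt_of_le (Set.mem_Ici.1 hb) with rfl | hab
    · rw [ha.1.2]
      exact hpos hbc
    · have hac := hab.trans hbc
      have hlt := hf.lt_on_openSegment ha0 (ha0.trans hac.le) hac.ne
        (by rw [openSegment_eq_Ioo hac]; exact ⟨hab, hbc⟩)
      rwa [ha.1.2, max_eq_right (hpos hac).le] at hlt
  refine ⟨a, ha, hca, hmono, fun b hb => ?_, hmono.injOn, fun y hy => ?_⟩
  · exact ha.1.2.symm.trans_le (hmono.monotoneOn Set.self_mem_Ici hb hb)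
  · obtain ⟨c, hac, hyc⟩ := hlarge a y
    obtain ⟨d, hd, hdy⟩ := intermediate_value_Icc hac (hca.mono Set.Icc_subset_Ici_self)
      ⟨ha.1.2.trans_le hy, hyc⟩
    exact ⟨d, hd.1, hdy⟩

/-- The Laplace exponent integrand is integrable when the measure is finite and its support is
bounded above. -/
theorem MeasureTheory.integrable_exp_mul_sub_one {μ : Measure ℝ} [IsFiniteMeasure μ] {h β : ℝ}
    (hle : ∀ᵐ x ∂μ, x ≤ h) (hβ : 0 ≤ β) :
    Integrable (fun x : ℝ => Real.exp (β * x) - 1) μ := by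
  refine Integrable.sub (Integrable.of_bound (by fun_prop) (Real.exp (β * h)) ?_)
    (integrable_const 1)
  filter_upwards [hle] with x hx
  rw [Real.norm_eq_abs, Real.abs_exp]
  gcongr

theorem MeasureTheory.continuousOn_integral_exp_mul_sub_one {μ : Measure ℝ} [IsFiniteMeasure μ]
    {h : ℝ} (hh : 0 ≤ h) (hle : ∀ᵐ x ∂μ, x ≤ h) :
    ContinuousOn (fun β : ℝ => ∫ x : ℝ, (Real.exp (β * x) - 1) ∂μ) (Set.Ici 0) := by
  intro β₀ hβ₀
  refine continuousWithinAt_of_dominated (bound := fun _ => Real.exp ((β₀ + 1) * h) + 1)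
    (Filter.Eventually.of_forall fun β => by fun_prop) ?_ (integrable_const _)
    (Filter.Eventually.of_forall fun x => by fun_prop)
  filter_upwards [self_mem_nhdsWithin,
    mem_nhdsWithin_of_mem_nhds (Iio_mem_nhds (lt_add_one β₀))] with β hβ hβ'
  filter_upwards [hle] with x hx
  have hmul : β * x ≤ (β₀ + 1) * h :=
    (mul_le_mul_of_nonneg_left hx hβ).trans (mul_le_mul_of_nonneg_right (le_of_lt hβ') hh)
  have := Real.exp_le_exp.2 hmul
  rw [Real.norm_eq_abs, abs_le]
  constructor <;> linarith [Real.exp_pos (β * x), Real.exp_pos ((β₀ + 1) * h)]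

theorem MeasureTheory.strictConvexOn_integral_exp_mul_sub_one {μ : Measure ℝ} [IsFiniteMeasure μ]
    {h : ℝ} (hh : h ≠ 0) (hle : ∀ᵐ x ∂μ, x ≤ h) (hat : μ {h} ≠ 0) :
    StrictConvexOn ℝ (Set.Ici 0) (fun β : ℝ => ∫ x : ℝ, (Real.exp (β * x) - 1) ∂μ) := by
  refine ⟨convex_Ici 0, fun b hb c hc hbc s t hs ht hst => ?_⟩
  have hib := (integrable_exp_mul_sub_one hle hb).const_mul s
  have hic := (integrable_exp_mul_sub_one hle hc).const_mul t
  have hsbtc : 0 ≤ s * b + t * c :=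
    add_nonneg (mul_nonneg hs.le hb) (mul_nonneg ht.le hc)
  simp only [smul_eq_mul]
  rw [← integral_const_mul, ← integral_const_mul, ← integral_add hib hic]
  have hia := integrable_exp_mul_sub_one hle hsbtc
  have hibc : Integrable
      (fun x => s * (Real.exp (b * x) - 1) + t * (Real.exp (c * x) - 1)) μ := hib.add hic
  rw [← sub_pos, ← integral_sub hibc hia]
  refine (integral_pos_iff_support_of_nonneg (fun x => ?_) (hibc.sub hia)).2 ?_
  · have := convexOn_exp.2 (Set.mem_univ (b * x)) (Set.mem_univ (c * x)) hs.le ht.le hst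
    simp only [smul_eq_mul] at this
    rw [show s * (b * x) + t * (c * x) = (s * b + t * c) * x by ring] at this
    simp only [Pi.zero_apply, Pi.sub_apply]
    linarith
  · refine (pos_iff_ne_zero.2 hat).trans_le (measure_mono (Set.singleton_subset_iff.2 ?_))
    have := strictConvexOn_exp.2 (Set.mem_univ (b * h)) (Set.mem_univ (c * h))
      (fun e => hbc (mul_right_cancel₀ hh e)) hs ht hst
    simp only [smul_eq_mul] at this
    rw [show s * (b * h) + t * (c * h) = (s * b + t * c) * h by ring] at this
    refine Function.mem_support.2 (ne_of_gt ?_)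
    simp only [Pi.sub_apply]
    linarith

theorem MeasureTheory.tendsto_integral_exp_mul_sub_one_atTop {μ : Measure ℝ} [IsFiniteMeasure μ]
    {h : ℝ} (hh : 0 < h) (hle : ∀ᵐ x ∂μ, x ≤ h) (hat : μ {h} ≠ 0) :
    Filter.Tendsto (fun β : ℝ => ∫ x : ℝ, (Real.exp (β * x) - 1) ∂μ)
      Filter.atTop Filter.atTop := by
  have hmass : 0 < μ.real {h} := ENNReal.toReal_pos hat (measure_ne_top _ _)
  have hlower : Filter.Tendsto (fun β : ℝ => Real.exp (β * h) * μ.real {h} - μ.real Set.univ)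
      Filter.atTop Filter.atTop :=
    Filter.tendsto_atTop_add_const_right _ _ ((Real.tendsto_exp_atTop.comp
      (Filter.tendsto_id.atTop_mul_const hh)).atTop_mul_const hmass)
  refine Filter.tendsto_atTop_mono' _ ?_ hlower
  filter_upwards [Filter.eventually_ge_atTop 0] with β hβ
  have hind : Integrable (({h} : Set ℝ).indicator fun _ => Real.exp (β * h)) μ :=
    (integrable_const _).indicator (measurableSet_singleton h)
  calc Real.exp (β * h) * μ.real {h} - μ.real Set.univ
      = ∫ x, (({h} : Set ℝ).indicator (fun _ => Real.exp (β * h)) x - 1) ∂μ := by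
        rw [integral_sub hind (integrable_const 1),
          integral_indicator_const _ (measurableSet_singleton h)]
        simp [mul_comm]
    _ ≤ ∫ x, (Real.exp (β * x) - 1) ∂μ := by
        refine integral_mono (hind.sub (integrable_const 1))
          (integrable_exp_mul_sub_one hle hβ) fun x => ?_
        refine sub_le_sub_right (Set.indicator_le' (g := fun y => Real.exp (β * y))
          (fun y hy => ?_) (fun y _ => ?_) x) 1
        · rw [Set.mem_singleton_iff.1 hy]
        · exact (Real.exp_pos _).le

/-- The zero set `Z = {β ∈ [0,∞) : ψ(β) = 0}` of the Laplace exponent has a maximum `Φ₀`, and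
`ψ` restricted to `[Φ₀, ∞)` is continuous, strictly increasing and maps `[Φ₀,∞)` bijectively
onto `[0,∞)` (hence admits an inverse bijection `Φ : [0,∞) → [Φ₀,∞)`). -/
theorem stmt4 (h : ℝ) (hh : 0 < h) (lam : Measure ℝ) [IsFiniteMeasure lam] (hne : lam ≠ 0)
    (hzero : lam {0} = 0)
    (hsupp : lam {x : ℝ | ∀ k : ℤ, x ≠ k * h} = 0)
    (hIoi : lam (Set.Ioi (0 : ℝ)) = lam {h}) (hath : 0 < lam {h}) :
    ∃ Φ₀ : ℝ,
      IsGreatest {β : ℝ | 0 ≤ β ∧ (∫ x : ℝ, (Real.exp (β * x) - 1) ∂lam) = 0} Φ₀ ∧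
      ContinuousOn (fun β : ℝ => ∫ x : ℝ, (Real.exp (β * x) - 1) ∂lam) (Set.Ici Φ₀) ∧
      StrictMonoOn (fun β : ℝ => ∫ x : ℝ, (Real.exp (β * x) - 1) ∂lam) (Set.Ici Φ₀) ∧
      Set.BijOn (fun β : ℝ => ∫ x : ℝ, (Real.exp (β * x) - 1) ∂lam)
        (Set.Ici Φ₀) (Set.Ici 0) := by
  have hle : ∀ᵐ x ∂lam, x ≤ h := by
    have hdiff : lam (Set.Ioi 0 \ {h}) = 0 := by
      rw [measure_sdiff (Set.singleton_subset_iff.2 (Set.mem_Ioi.2 hh))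
        (measurableSet_singleton h).nullMeasurableSet (measure_ne_top _ _), hIoi, tsub_self]
    refine measure_mono_null (fun x hx => ?_) hdiff
    have hx' : h < x := not_le.1 hx
    exact ⟨hh.trans hx', hx'.ne'⟩
  exact (strictConvexOn_integral_exp_mul_sub_one hh.ne' hle hath.ne').exists_isGreatest_zero_bijOn
    (continuousOn_integral_exp_mul_sub_one hh.le hle) (by simp)
    (tendsto_integral_exp_mul_sub_one_atTop hh hle hath.ne')
end

section
/- Let q ≥ 0 and let Φq ∈ [0,∞) satisfy ψ(Φq) = q and ψ(β) > q for every β > Φq. Put γ := λ(ℝ), p := λ({h})/γ and q_l := λ({−lh})/γ for l ≥ 1. Let (w_k)_{k≥0} be the real sequence determined by w_0 = 1/(h·λ({h})) and p·w_{k+1} = (1 + q/γ)·w_k − Σ_{l=1}^{k} q_l·w_{k−l} for k ≥ 0, and assume Σ_{k≥0} |w_k|·e^{−βkh} < ∞ for every β > Φq. Define W^{(q)}(x) := w_{⌊x/h⌋} for x ≥ 0, and Z^{(q)}(x) := 1 + q·∫_0^{⌊x/h⌋·h} W^{(q)}(z) dz for x ≥ 0. Then for every β > Φq: ∫_0^∞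 e^{−βx}·Z^{(q)}(x) dx = (1/β)·(1 + q/(ψ(β) − q)). -/
open MeasureTheory

/-- The points `h, 0, -h, -2h, …` carry an upwards skip-free measure supported on `ℤ_h`. -/
lemma ae_mem_iUnion_of_skipFree {h : ℝ} (hh : 0 < h) (lam : Measure ℝ) [IsFiniteMeasure lam]
    (hsupp : lam {x : ℝ | ∀ k : ℤ, x ≠ k * h} = 0)
    (hIoi : lam (Set.Ioi (0 : ℝ)) = lam {h}) :
    ∀ᵐ x ∂lam, x ∈ ⋃ j : ℕ, ({(1 - (j : ℝ)) * h} : Set ℝ) := by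
  have hdiff : lam (Set.Ioi (0 : ℝ) \ {h}) = 0 := by
    rw [measure_sdiff (by simpa using hh) (measurableSet_singleton h).nullMeasurableSet
      (measure_ne_top _ _), hIoi, tsub_self]
  refine measure_mono_null ?_ (measure_union_null hsupp hdiff)
  intro x hx
  by_contra hcon
  simp only [Set.mem_union, Set.mem_ofPred_eq, Set.mem_sdiff, Set.mem_Ioi,
    Set.mem_singleton_iff, not_or, not_forall, not_not] at hcon
  obtain ⟨⟨k, hk⟩, hpos⟩ := hcon
  apply hx
  simp only [Set.mem_iUnion, Set.mem_singleton_iff]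
  rcases le_or_gt k 1 with hk1 | hk1
  · refine ⟨(1 - k).toNat, ?_⟩
    have hcast : (((1 - k).toNat : ℕ) : ℝ) = 1 - (k : ℝ) := by
      have : (((1 - k).toNat : ℕ) : ℤ) = 1 - k := Int.toNat_of_nonneg (by omega)
      exact_mod_cast this
    rw [hcast, hk]
    ring
  · have hk2 : (1 : ℝ) < k := by exact_mod_cast hk1
    have hxpos : 0 < x := by rw [hk]; positivity
    refine ⟨0, ?_⟩
    have := not_not.1 (fun hn => hpos ⟨hxpos, hn⟩)
    simpa using this

lemma injective_one_sub_mul {h : ℝ} (hh : 0 < h) :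
    Function.Injective (fun j : ℕ => (1 - (j : ℝ)) * h) := by
  intro i j hij
  have := mul_right_cancel₀ hh.ne' hij
  have : (i : ℝ) = j := by linarith
  exact_mod_cast this

lemma integrable_exp_of_skipFree {h : ℝ} (hh : 0 < h) (lam : Measure ℝ) [IsFiniteMeasure lam]
    (hsupp : lam {x : ℝ | ∀ k : ℤ, x ≠ k * h} = 0)
    (hIoi : lam (Set.Ioi (0 : ℝ)) = lam {h}) {β : ℝ} (hβ : 0 ≤ β) :
    Integrable (fun x => Real.exp (β * x)) lam := by
  refine Integrable.of_bound (by fun_prop) (Real.exp (β * h)) ?_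
  filter_upwards [ae_mem_iUnion_of_skipFree hh lam hsupp hIoi] with x hx
  simp only [Set.mem_iUnion, Set.mem_singleton_iff] at hx
  obtain ⟨j, rfl⟩ := hx
  rw [Real.norm_eq_abs, Real.abs_exp, Real.exp_le_exp]
  have : 0 ≤ (j : ℝ) * h := by positivity
  exact mul_le_mul_of_nonneg_left (by linarith) hβ

/-- The exponential moments of an upwards skip-free measure are a power series in `e^{-βh}`. -/
lemma hasSum_integral_exp_of_skipFree {h : ℝ} (hh : 0 < h) (lam : Measure ℝ) [IsFiniteMeasure lam]
    (hsupp : lam {x : ℝ | ∀ k : ℤ, x ≠ k * h} = 0)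
    (hIoi : lam (Set.Ioi (0 : ℝ)) = lam {h}) {β : ℝ} (hβ : 0 ≤ β) :
    HasSum (fun j : ℕ => (lam {(1 - (j : ℝ)) * h}).toReal * Real.exp (-β * h) ^ j)
      (Real.exp (-β * h) * ∫ x, Real.exp (β * x) ∂lam) := by
  have hint := integrable_exp_of_skipFree hh lam hsupp hIoi hβ
  have hsum := hasSum_integral_iUnion (μ := lam) (f := fun x => Real.exp (β * x))
    (s := fun j : ℕ => ({(1 - (j : ℝ)) * h} : Set ℝ))
    (fun j => measurableSet_singleton _)
    (fun i j hij => Set.disjoint_singleton.2 ((injective_one_sub_mul hh).ne hij)) hint.integrableOn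
  rw [setIntegral_eq_integral_of_ae_compl_eq_zero] at hsum
  · refine (hsum.mul_left (Real.exp (-β * h))).congr_fun ?_
    intro j
    rw [integral_singleton, measureReal_def, smul_eq_mul, mul_left_comm, ← Real.exp_add,
      ← Real.exp_nat_mul]
    congr 2
    ring
  · filter_upwards [ae_mem_iUnion_of_skipFree hh lam hsupp hIoi] with x hx hx'
    exact absurd hx hx'

lemma floor_div_eq_of_mem_Ico {h : ℝ} (hh : 0 < h) {n : ℕ} {x : ℝ}
    (hx : x ∈ Set.Ico ((n : ℝ) * h) (((n + 1 : ℕ) : ℝ) * h)) : ⌊x / h⌋ = (n : ℤ) := by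
  rw [Int.floor_eq_iff]
  push_cast at hx ⊢
  exact ⟨(le_div_iff₀ hh).2 hx.1, (div_lt_iff₀ hh).2 hx.2⟩

lemma iUnion_Ico_nat_mul {h : ℝ} (hh : 0 < h) :
    ⋃ n : ℕ, Set.Ico ((n : ℝ) * h) (((n + 1 : ℕ) : ℝ) * h) = Set.Ici 0 := by
  ext x
  simp only [Set.mem_iUnion, Set.mem_Ico, Set.mem_Ici]
  constructor
  · rintro ⟨n, hn, -⟩
    exact le_trans (by positivity) hn
  · intro hx
    refine ⟨⌊x / h⌋₊, (le_div_iff₀ hh).1 (Nat.floor_le (by positivity)), (div_lt_iff₀ hh).1 ?_⟩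
    push_cast
    exact Nat.lt_floor_add_one _

lemma integral_exp_neg_Ico {h β : ℝ} (hh : 0 < h) (hβ : 0 < β) (n : ℕ) :
    ∫ x in Set.Ico ((n : ℝ) * h) (((n + 1 : ℕ) : ℝ) * h), Real.exp (-β * x)
      = (1 - Real.exp (-β * h)) / β * Real.exp (-β * h) ^ n := by
  have hle : (n : ℝ) * h ≤ ((n + 1 : ℕ) : ℝ) * h := by push_cast; nlinarith
  rw [integral_Ico_eq_integral_Ioc, ← intervalIntegral.integral_of_le hle,
    intervalIntegral.integral_comp_mul_left (fun y => Real.exp y) (neg_ne_zero.2 hβ.ne'),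
    integral_exp, ← Real.exp_nat_mul]
  have : -β * (((n + 1 : ℕ) : ℝ) * h) = n * (-β * h) + -β * h := by push_cast; ring
  rw [this, Real.exp_add, show -β * ((n : ℝ) * h) = n * (-β * h) by ring, smul_eq_mul]
  field_simp
  ring

/-- The Laplace transform of a function that is constant on each `[nh, (n+1)h)`. -/
lemma integral_exp_mul_step {h β : ℝ} (hh : 0 < h) (hβ : 0 < β) (f : ℕ → ℝ) (F : ℝ → ℝ)
    (hF : ∀ n : ℕ, ∀ x ∈ Set.Ico ((n : ℝ) * h) (((n + 1 : ℕ) : ℝ) * h), F x = f n)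
    (hsum : Summable fun n => ‖f n * Real.exp (-β * h) ^ n‖) :
    ∫ x in Set.Ioi (0 : ℝ), Real.exp (-β * x) * F x
      = (1 - Real.exp (-β * h)) / β * ∑' n, f n * Real.exp (-β * h) ^ n := by
  set s : ℕ → Set ℝ := fun n => Set.Ico ((n : ℝ) * h) (((n + 1 : ℕ) : ℝ) * h) with hs
  have hmeas : ∀ n, MeasurableSet (s n) := fun n => measurableSet_Ico
  have hmono : Monotone fun n : ℕ => (n : ℝ) * h := fun a b hab => by
    have : (a : ℝ) ≤ b := by exact_mod_cast hab
    exact mul_le_mul_of_nonneg_right this hh.le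
  have hdisj : Pairwise (Function.onFun Disjoint s) := hmono.pairwise_disjoint_on_Ico_succ
  have hexp : ∀ n, IntegrableOn (fun x => Real.exp (-β * x)) (s n) := fun n =>
    (Continuous.integrableOn_Icc (by fun_prop)).mono_set Set.Ico_subset_Icc_self
  have hI : ∀ n, IntegrableOn (fun x => Real.exp (-β * x) * F x) (s n) := fun n =>
    IntegrableOn.congr_fun ((hexp n).mul_const (f n)) (fun x hx => by simp [hF n x hx]) (hmeas n)
  have hval : ∀ n, ∫ x in s n, Real.exp (-β * x) * F x
      = (1 - Real.exp (-β * h)) / β * (f n * Real.exp (-β * h) ^ n) := fun n => by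
    rw [setIntegral_congr_fun (g := fun x => Real.exp (-β * x) * f n) (hmeas n)
      (fun x hx => by simp [hF n x hx]), integral_mul_const, integral_exp_neg_Ico hh hβ]
    ring
  have hnorm : ∀ n, ∫ x in s n, ‖Real.exp (-β * x) * F x‖
      = (1 - Real.exp (-β * h)) / β * ‖f n * Real.exp (-β * h) ^ n‖ := fun n => by
    rw [setIntegral_congr_fun (g := fun x => Real.exp (-β * x) * ‖f n‖) (hmeas n)
      (fun x hx => by simp [hF n x hx]), integral_mul_const, integral_exp_neg_Ico hh hβ,
      norm_mul, norm_pow, Real.norm_of_nonneg (Real.exp_pos _).le]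
    ring
  have hIU : IntegrableOn (fun x => Real.exp (-β * x) * F x) (⋃ n, s n) := by
    refine integrableOn_iUnion_of_summable_integral_norm hI ?_
    simp_rw [hnorm]
    exact hsum.mul_left _
  have := hasSum_integral_iUnion hmeas hdisj hIU
  simp_rw [hval] at this
  rw [← integral_Ici_eq_integral_Ioi, ← iUnion_Ico_nat_mul hh, ← this.tsum_eq, tsum_mul_left]

lemma integral_zero_nat_mul_step {h : ℝ} (hh : 0 < h) (w : ℕ → ℝ) (n : ℕ) :
    ∫ z in (0 : ℝ)..((n : ℝ) * h), w (⌊z / h⌋.toNat) = h * ∑ k ∈ Finset.range n, w k := by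
  have hmono (k : ℕ) : (k : ℝ) * h ≤ ((k + 1 : ℕ) : ℝ) * h := by push_cast; nlinarith
  have heq (k : ℕ) : Set.EqOn (fun z => w (⌊z / h⌋.toNat)) (fun _ => w k)
      (Set.Ico ((k : ℝ) * h) (((k + 1 : ℕ) : ℝ) * h)) := fun z hz => by
    simp [floor_div_eq_of_mem_Ico hh hz]
  have hint (k : ℕ) : IntervalIntegrable (fun z => w (⌊z / h⌋.toNat)) volume
      ((k : ℝ) * h) (((k + 1 : ℕ) : ℝ) * h) := by
    rw [intervalIntegrable_iff_integrableOn_Ico_of_le (hmono k)]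
    exact IntegrableOn.congr_fun (integrableOn_const (by simp)) (heq k).symm measurableSet_Ico
  have := intervalIntegral.sum_integral_adjacent_intervals (n := n)
    (a := fun k : ℕ => (k : ℝ) * h) (fun k _ => hint k)
  simp only [Nat.cast_zero, zero_mul] at this
  rw [← this, Finset.mul_sum]
  refine Finset.sum_congr rfl fun k _ => ?_
  rw [intervalIntegral.integral_of_le (hmono k), ← integral_Ico_eq_integral_Ioc,
    setIntegral_congr_fun measurableSet_Ico (heq k), setIntegral_const, measureReal_def,
    Real.volume_Ico, ENNReal.toReal_ofReal (sub_nonneg.2 (hmono k)), smul_eq_mul]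
  push_cast
  ring

/-- The generating function of partial sums. -/
lemma tsum_partial_sum_mul_pow {w : ℕ → ℝ} {s : ℝ} (hs0 : 0 ≤ s) (hs1 : s < 1)
    (hw : Summable fun k => ‖w k * s ^ k‖) :
    (Summable fun n => ‖(∑ k ∈ Finset.range n, w k) * s ^ n‖) ∧
      ∑' n, (∑ k ∈ Finset.range n, w k) * s ^ n = s / (1 - s) * ∑' k, w k * s ^ k := by
  have hg : Summable fun k : ℕ => ‖s ^ k‖ := by
    simpa [abs_of_nonneg hs0] using summable_geometric_of_lt_one hs0 hs1
  have hterm (n : ℕ) : ∑ k ∈ Finset.range (n + 1), (w k * s ^ k) * s ^ (n - k)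
      = (∑ k ∈ Finset.range (n + 1), w k) * s ^ n := by
    rw [Finset.sum_mul]
    refine Finset.sum_congr rfl fun k hk => ?_
    rw [mul_assoc, ← pow_add, Nat.add_sub_cancel' (Finset.mem_range_succ_iff.1 hk)]
  have hprod := tsum_mul_tsum_eq_tsum_sum_range_of_summable_norm hw hg
  have hsum := summable_norm_sum_mul_range_of_summable_norm hw hg
  simp_rw [hterm] at hprod hsum
  have hsum' : Summable fun n => ‖(∑ k ∈ Finset.range n, w k) * s ^ n‖ := by
    rw [← summable_nat_add_iff 1]
    refine (hsum.mul_right ‖s‖).congr fun n => ?_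
    rw [← norm_mul, pow_succ, mul_assoc]
  refine ⟨hsum', ?_⟩
  rw [hsum'.of_norm.tsum_eq_zero_add]
  simp only [Finset.range_zero, Finset.sum_empty, zero_mul, zero_add, pow_succ, ← mul_assoc]
  rw [tsum_mul_right, ← hprod, tsum_geometric_of_lt_one hs0 hs1]
  ring

/-- A convolution recursion determines the generating function. -/
lemma tsum_mul_tsum_of_convolution {a w : ℕ → ℝ} {c s : ℝ}
    (ha : Summable fun k => ‖a k * s ^ k‖) (hw : Summable fun k => ‖w k * s ^ k‖)
    (hrec : ∀ k, ∑ j ∈ Finset.range (k + 2), a j * w (k + 1 - j) = c * w k) :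
    (∑' k, a k * s ^ k) * (∑' k, w k * s ^ k) = a 0 * w 0 + c * s * ∑' k, w k * s ^ k := by
  have hterm (n : ℕ) : ∑ k ∈ Finset.range (n + 1), (a k * s ^ k) * (w (n - k) * s ^ (n - k))
      = (∑ k ∈ Finset.range (n + 1), a k * w (n - k)) * s ^ n := by
    rw [Finset.sum_mul]
    refine Finset.sum_congr rfl fun k hk => ?_
    rw [← Nat.add_sub_cancel' (Finset.mem_range_succ_iff.1 hk), pow_add, Nat.add_sub_cancel_left]
    ring
  have hsum := (summable_norm_sum_mul_range_of_summable_norm ha hw).of_norm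
  rw [tsum_mul_tsum_eq_tsum_sum_range_of_summable_norm ha hw, hsum.tsum_eq_zero_add]
  simp_rw [hterm, hrec, pow_succ]
  rw [← tsum_mul_left]
  congr 1
  · simp
  · exact tsum_congr fun k => by ring

/-- The function `Z^{(q)}(x) = 1 + q·∫_0^{⌊x/h⌋h} W^{(q)}(z) dz` built from the `q`-scale
function `W^{(q)}(x) = w_{⌊x/h⌋}` of an upwards skip-free Lévy chain has Laplace transform
`∫_0^∞ e^{−βx} Z^{(q)}(x) dx = (1/β)(1 + q/(ψ(β) − q))` for `β > Φ(q)`. -/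
theorem stmt19 (h : ℝ) (hh : 0 < h) (lam : Measure ℝ) [IsFiniteMeasure lam] (hne : lam ≠ 0)
    (hzero : lam {0} = 0)
    (hsupp : lam {x : ℝ | ∀ k : ℤ, x ≠ k * h} = 0)
    (hIoi : lam (Set.Ioi (0 : ℝ)) = lam {h}) (hath : 0 < lam {h})
    (q : ℝ) (hq : 0 ≤ q)
    (Φq : ℝ) (hΦq0 : 0 ≤ Φq)
    (hroot : (∫ x : ℝ, (Real.exp (Φq * x) - 1) ∂lam) = q)
    (hlargest : ∀ β : ℝ, Φq < β → q < ∫ x : ℝ, (Real.exp (β * x) - 1) ∂lam)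
    (w : ℕ → ℝ) (hw0 : w 0 = 1 / (h * (lam {h}).toReal))
    (hwrec : ∀ k : ℕ,
      ((lam {h}).toReal / (lam Set.univ).toReal) * w (k + 1)
        = (1 + q / (lam Set.univ).toReal) * w k
          - ∑ l ∈ Finset.Icc 1 k,
              ((lam {-(l : ℝ) * h}).toReal / (lam Set.univ).toReal) * w (k - l))
    (hsummable : ∀ β : ℝ, Φq < β →
      Summable (fun k : ℕ => |w k| * Real.exp (-β * k * h))) :
    ∀ β : ℝ, Φq < β →
      (∫ x in Set.Ioi (0 : ℝ),
          Real.exp (-β * x)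
            * (1 + q * ∫ z in (0 : ℝ)..((⌊x / h⌋ : ℝ) * h), w (⌊z / h⌋.toNat)))
        = (1 / β) * (1 + q / ((∫ x : ℝ, (Real.exp (β * x) - 1) ∂lam) - q)) := by
  intro β hβ
  have hβ0 : 0 < β := hΦq0.trans_lt hβ
  set s := Real.exp (-β * h) with hs
  have hs0 : 0 < s := Real.exp_pos _
  have hs1 : s < 1 := by
    rw [hs, Real.exp_lt_one_iff]
    nlinarith
  have hp : 0 < (lam {h}).toReal := ENNReal.toReal_pos hath.ne' (measure_ne_top _ _)
  have hγ : 0 < (lam Set.univ).toReal :=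
    ENNReal.toReal_pos (by simpa using hne) (measure_ne_top _ _)
  have hw : Summable fun k => ‖w k * s ^ k‖ := by
    refine (hsummable β hβ).congr fun k => ?_
    rw [norm_mul, norm_pow, Real.norm_of_nonneg hs0.le, Real.norm_eq_abs, hs,
      ← Real.exp_nat_mul]
    congr 2
    ring
  have hA := hasSum_integral_exp_of_skipFree hh lam hsupp hIoi hβ0.le
  rw [← hs] at hA
  have hψ : ∫ x : ℝ, (Real.exp (β * x) - 1) ∂lam
      = (∫ x, Real.exp (β * x) ∂lam) - (lam Set.univ).toReal := by
    rw [integral_sub (integrable_exp_of_skipFree hh lam hsupp hIoi hβ0.le) (integrable_const _)]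
    simp [measureReal_def]
  have hrec (k : ℕ) : ∑ j ∈ Finset.range (k + 2),
      (lam {(1 - (j : ℝ)) * h}).toReal * w (k + 1 - j)
        = ((lam Set.univ).toReal + q) * w k := by
    have hk := hwrec k
    rw [Finset.sum_range_succ', Finset.sum_range_succ']
    have hshift : ∑ l ∈ Finset.Icc 1 k,
        ((lam {-(l : ℝ) * h}).toReal / (lam Set.univ).toReal) * w (k - l)
        = (∑ j ∈ Finset.range k, (lam {(1 - ((j + 1 + 1 : ℕ) : ℝ)) * h}).toReal
          * w (k + 1 - (j + 1 + 1))) / (lam Set.univ).toReal := by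
      rw [Finset.sum_div, ← Finset.Ico_add_one_right_eq_Icc, Finset.sum_Ico_eq_sum_range]
      refine Finset.sum_congr rfl fun j _ => ?_
      have h1 : -((1 + j : ℕ) : ℝ) * h = (1 - ((j + 1 + 1 : ℕ) : ℝ)) * h := by push_cast; ring
      have h2 : k + 1 - (j + 1 + 1) = k - (1 + j) := by omega
      rw [h1, h2]
      ring
    rw [hshift] at hk
    field_simp at hk
    simp only [zero_add, Nat.cast_one, sub_self, zero_mul, hzero, ENNReal.toReal_zero, add_zero,
      Nat.cast_zero, sub_zero, Nat.sub_zero, one_mul]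
    linarith
  have hconv := tsum_mul_tsum_of_convolution hA.summable.norm hw hrec
  rw [hA.tsum_eq] at hconv
  obtain ⟨hS, hSeq⟩ := tsum_partial_sum_mul_pow hs0.le hs1 hw
  have hgeo := summable_geometric_of_lt_one hs0.le hs1
  have hsplit (n : ℕ) : (1 + q * (h * ∑ k ∈ Finset.range n, w k)) * s ^ n
      = s ^ n + q * h * ((∑ k ∈ Finset.range n, w k) * s ^ n) := by ring
  rw [integral_exp_mul_step hh hβ0 (fun n => 1 + q * (h * ∑ k ∈ Finset.range n, w k)) _
    (fun n x hx => by
      rw [floor_div_eq_of_mem_Ico hh hx, Int.cast_natCast, integral_zero_nat_mul_step hh])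
    (by
      simp_rw [← hs, hsplit]
      exact (hgeo.add (hS.of_norm.mul_left _)).norm)]
  simp_rw [← hs, hsplit]
  rw [hgeo.tsum_add (hS.of_norm.mul_left _), tsum_mul_left, hSeq,
    tsum_geometric_of_lt_one hs0.le hs1, hψ]
  have hpos : 0 < (∫ x, Real.exp (β * x) ∂lam) - (lam Set.univ).toReal - q := by
    have := hlargest β hβ
    rw [hψ] at this
    linarith
  set G := ∑' k, w k * s ^ k
  set E := ∫ x, Real.exp (β * x) ∂lam
  have hG : h * s * G = 1 / (E - (lam Set.univ).toReal - q) := by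
    rw [eq_div_iff hpos.ne']
    rw [hw0] at hconv
    simp only [Nat.cast_zero, sub_zero, one_mul] at hconv
    have h3 : h * ((lam {h}).toReal * (1 / (h * (lam {h}).toReal))) = 1 := by
      field_simp
    linear_combination h * hconv + h3
  have h1s : 1 - s ≠ 0 := (sub_pos.2 hs1).ne'
  rw [div_eq_mul_one_div q, ← hG]
  field_simp
end
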